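/- arXiv:1205.6487 — 2 statements merged into one kernel-verified Lean document; each statement's English description precedes it below -/
import Mathlib

section
/- Let T be a tree consisting of a root vertex v_0 adjacent to p ≥ 0 leaves and to r ≥ 2 vertices v_1, …, v_r, where each v_i is additionally adjacent to s_i ≥ 1 leaves (so T has diameter 4 and n = 1 + p + r + s_1 + ⋯ + s_r vertices). Let σ be the number of Laplacian eigenvalues of T strictly larger than the average degree d̄ = 2 − 2/n. Then σ = r or σ = r + 1. Moreover, if p ≥ 1, or if at least three of the values s_1, …, s_r are at least 2, then σ = r + 1. -/
open Polynomial

namespace LapPaper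

variable {V : Type} [Fintype V] [DecidableEq V]

/-- The multiset of Laplacian eigenvalues of `G` (with multiplicity), given as the
real roots of the characteristic polynomial of the Laplacian matrix `L = D - A`. -/
noncomputable def lapSpectrum (G : SimpleGraph V) [DecidableRel G.Adj] : Multiset ℝ :=
  (G.lapMatrix ℝ).charpoly.roots

/-- The average degree `d̄ = 2|E|/n` of a graph. -/
noncomputable def avgDeg (G : SimpleGraph V) [DecidableRel G.Adj] : ℝ :=
  2 * G.edgeFinset.card / Fintype.card V

/-- The Laplacian energy `LE(G) = ∑_i |μ_i - d̄|`. -/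
noncomputable def LE (G : SimpleGraph V) [DecidableRel G.Adj] : ℝ :=
  ((lapSpectrum G).map (fun x => |x - avgDeg G|)).sum

/-- `Sk G k` is the sum of the `k` largest Laplacian eigenvalues `μ_1 + ⋯ + μ_k` of `G`. -/
noncomputable def Sk (G : SimpleGraph V) [DecidableRel G.Adj] (k : ℕ) : ℝ :=
  ((((lapSpectrum G).sort (· ≤ ·)).reverse).take k).sum

/-- The number `σ` of Laplacian eigenvalues of `G` strictly larger than the average degree. -/
noncomputable def sigma (G : SimpleGraph V) [DecidableRel G.Adj] : ℕ :=
  Multiset.card ((lapSpectrum G).filter (fun x => avgDeg G < x))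

/-- The double star `T(a,b)` on `a + b + 2` vertices: vertex `0` is adjacent to vertex `1`
and to the `a` leaves `2, …, a+1`; vertex `1` is adjacent to the `b` leaves `a+2, …, a+b+1`. -/
def doubleStar (a b : ℕ) : SimpleGraph (Fin (a + b + 2)) :=
  SimpleGraph.fromRel (fun u v =>
    (u.1 = 0 ∧ v.1 = 1) ∨ (u.1 = 0 ∧ 2 ≤ v.1 ∧ v.1 < a + 2) ∨ (u.1 = 1 ∧ a + 2 ≤ v.1))

noncomputable instance (a b : ℕ) : DecidableRel (doubleStar a b).Adj := Classical.decRel _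

/-- The star on `n` vertices: vertex `0` is adjacent to all other vertices. -/
def starGraph (n : ℕ) : SimpleGraph (Fin n) :=
  SimpleGraph.fromRel (fun u _ => u.1 = 0)

noncomputable instance (n : ℕ) : DecidableRel (starGraph n).Adj := Classical.decRel _

end LapPaper

namespace LapPaper

/-- The diameter-4 tree with a root `Sum.inl ()` adjacent to `p` pendant leaves
`Sum.inr (Sum.inl j)` and to `r` vertices `Sum.inr (Sum.inr ⟨i, Sum.inl ()⟩)`, where the
`i`-th of these is additionally adjacent to the `s i` leaves `Sum.inr (Sum.inr ⟨i, Sum.inr j⟩)`. -/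
def diam4Tree (p r : ℕ) (s : Fin r → ℕ) :
    SimpleGraph (Unit ⊕ (Fin p ⊕ (Σ i : Fin r, Unit ⊕ Fin (s i)))) :=
  SimpleGraph.fromRel (fun u v =>
    (∃ j : Fin p, u = Sum.inl () ∧ v = Sum.inr (Sum.inl j)) ∨
    (∃ i : Fin r, u = Sum.inl () ∧ v = Sum.inr (Sum.inr ⟨i, Sum.inl ()⟩)) ∨
    (∃ (i : Fin r) (j : Fin (s i)), u = Sum.inr (Sum.inr ⟨i, Sum.inl ()⟩) ∧
      v = Sum.inr (Sum.inr ⟨i, Sum.inr j⟩)))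

noncomputable instance (p r : ℕ) (s : Fin r → ℕ) : DecidableRel (diam4Tree p r s).Adj :=
  Classical.decRel _


open Matrix

theorem dotProduct_mulVec_eq_sum_eigenvalues {ι : Type*} [Fintype ι] [DecidableEq ι]
    {A : Matrix ι ι ℝ} (hA : A.IsHermitian) (x : ι → ℝ) :
    x ⬝ᵥ A *ᵥ x =
      ∑ i, hA.eigenvalues i * ((star (hA.eigenvectorUnitary : Matrix ι ι ℝ) *ᵥ x) i) ^ 2 := by
  conv_lhs => rw [hA.spectral_theorem, Unitary.conjStarAlgAut_apply, ← mulVec_mulVec,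
    ← mulVec_mulVec, dotProduct_mulVec, ← mulVec_transpose]
  simp only [dotProduct, mulVec_diagonal, star_eq_conjTranspose,
    conjTranspose_eq_transpose_of_trivial]
  refine Finset.sum_congr rfl fun i _ => ?_
  simp
  ring

theorem dotProduct_self_eq_sum_eigenvectorUnitary {ι : Type*} [Fintype ι] [DecidableEq ι]
    {A : Matrix ι ι ℝ} (hA : A.IsHermitian) (x : ι → ℝ) :
    x ⬝ᵥ x = ∑ i, ((star (hA.eigenvectorUnitary : Matrix ι ι ℝ) *ᵥ x) i) ^ 2 := by
  have h := Unitary.coe_mul_star_self hA.eigenvectorUnitary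
  conv_lhs => rw [← congrArg (x ⬝ᵥ ·) (one_mulVec x), ← h, ← mulVec_mulVec, dotProduct_mulVec,
    ← mulVec_transpose]
  rw [Unitary.coe_star, star_eq_conjTranspose, conjTranspose_eq_transpose_of_trivial]
  simp only [dotProduct, pow_two]

open QuadraticMap in
/-- **Sylvester's law of inertia** as an eigenvalue count: diagonalizing the quadratic form of
`A - c` by any linear change of variables counts the eigenvalues of `A` exceeding `c`. -/
theorem card_charpoly_roots_gt_eq_ncard {ι : Type*} [Fintype ι] [DecidableEq ι]
    {A : Matrix ι ι ℝ} (hA : A.IsHermitian) (c : ℝ) (w : ι → ℝ)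
    (f : (ι → ℝ) →ₗ[ℝ] (ι → ℝ)) (hf : Function.Injective f)
    (h : ∀ x, x ⬝ᵥ A *ᵥ x - c * (x ⬝ᵥ x) = ∑ i, w i * (f x i) ^ 2) :
    Multiset.card (A.charpoly.roots.filter (c < ·)) = {i | 0 < w i}.ncard := by
  let U : Matrix ι ι ℝ := hA.eigenvectorUnitary
  have hU : U * star U = 1 := Unitary.coe_mul_star_self hA.eigenvectorUnitary
  have hU' : star U * U = 1 := Unitary.coe_star_mul_self hA.eigenvectorUnitary
  let e : (ι → ℝ) ≃ₗ[ℝ] (ι → ℝ) := Matrix.toLin'OfInv hU' hU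
  let g : (ι → ℝ) ≃ₗ[ℝ] (ι → ℝ) := LinearEquiv.ofInjectiveEndo f hf
  have key : (weightedSumSquares ℝ (fun i => hA.eigenvalues i - c)).Equivalent
      (weightedSumSquares ℝ w) := by
    refine ⟨⟨e.trans g, fun y => ?_⟩⟩
    have hy : star U *ᵥ (U *ᵥ y) = y := by rw [mulVec_mulVec, hU', one_mulVec]
    have := h (U *ᵥ y)
    rw [dotProduct_mulVec_eq_sum_eigenvalues hA, dotProduct_self_eq_sum_eigenvectorUnitary hA,
      Finset.mul_sum, ← Finset.sum_sub_distrib, hy] at this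
    simp only [weightedSumSquares_apply, smul_eq_mul, ← pow_two, sub_mul]
    have hg : (e.trans g).toFun y = f (U *ᵥ y) := by
      simp only [e, g, AddHom.toFun_eq_coe, LinearMap.coe_toAddHom, LinearEquiv.coe_coe,
        LinearEquiv.trans_apply, LinearEquiv.coe_ofInjectiveEndo]
      rfl
    rw [hg]
    exact this.symm
  rw [← QuadraticForm.sigPos_weightedSumSquares (𝕜 := ℝ), ← key.sigPos_eq,
    QuadraticForm.sigPos_weightedSumSquares, hA.roots_charpoly_eq_eigenvalues,
    Multiset.filter_map, Multiset.card_map, Set.ncard_eq_toFinset_card']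
  simp [Finset.card]

theorem diam4Tree_quadratic (p r : ℕ) (s : Fin r → ℕ)
    (x : Unit ⊕ (Fin p ⊕ (Σ i : Fin r, Unit ⊕ Fin (s i))) → ℝ) :
    x ⬝ᵥ (diam4Tree p r s).lapMatrix ℝ *ᵥ x =
      ∑ j : Fin p, (x (.inl ()) - x (.inr (.inl j))) ^ 2 +
      ∑ i : Fin r, ((x (.inl ()) - x (.inr (.inr ⟨i, .inl ()⟩))) ^ 2 +
        ∑ j : Fin (s i),
          (x (.inr (.inr ⟨i, .inl ()⟩)) - x (.inr (.inr ⟨i, .inr j⟩))) ^ 2) := by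
  rw [← toLinearMap₂'_apply', SimpleGraph.lapMatrix_toLinearMap₂']
  have h1 : ∀ j, (diam4Tree p r s).Adj (.inl ()) (.inr (.inl j)) := by
    intro j; simp [diam4Tree]
  have h2 : ∀ i, (diam4Tree p r s).Adj (.inl ()) (.inr (.inr ⟨i, .inl ()⟩)) := by
    intro j; simp [diam4Tree]
  have h3 : ∀ i j, ¬ (diam4Tree p r s).Adj (.inl ()) (.inr (.inr ⟨i, .inr j⟩)) := by
    intro i j; simp [diam4Tree]
  have h4 : ∀ j j', ¬ (diam4Tree p r s).Adj (.inr (.inl j)) (.inr (.inl j')) := by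
    intro j j'; simp [diam4Tree]
  have h5 : ∀ j y, ¬ (diam4Tree p r s).Adj (.inr (.inl j)) (.inr (.inr y)) := by
    intro j y; simp [diam4Tree]
  have h6 : ∀ i i', ¬ (diam4Tree p r s).Adj (.inr (.inr ⟨i, .inl ()⟩))
      (.inr (.inr ⟨i', .inl ()⟩)) := by
    intro i i'; simp [diam4Tree]; grind
  have h7 : ∀ i i' j, (diam4Tree p r s).Adj (.inr (.inr ⟨i, .inl ()⟩))
      (.inr (.inr ⟨i', .inr j⟩)) ↔ i = i' := by
    intro i i' j; simp [diam4Tree]; grind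
  have h8 : ∀ i i' j j', ¬ (diam4Tree p r s).Adj (.inr (.inr ⟨i, .inr j⟩))
      (.inr (.inr ⟨i', .inr j'⟩)) := by
    intro i i' j j'; simp [diam4Tree]
  have h1' := fun j => (h1 j).symm
  have h2' := fun j => (h2 j).symm
  have h3' : ∀ i j, ¬ (diam4Tree p r s).Adj (.inr (.inr ⟨i, .inr j⟩)) (.inl ()) :=
    fun i j h => h3 i j h.symm
  have h5' : ∀ j y, ¬ (diam4Tree p r s).Adj (.inr (.inr y)) (.inr (.inl j)) :=
    fun i j h => h5 i j h.symm
  have h7' : ∀ i i' j, (diam4Tree p r s).Adj (.inr (.inr ⟨i', .inr j⟩))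
      (.inr (.inr ⟨i, .inl ()⟩)) ↔ i = i' := fun i i' j => by
    rw [SimpleGraph.adj_comm, h7]
  have h0 : ¬ (diam4Tree p r s).Adj (.inl ()) (.inl ()) := SimpleGraph.irrefl _
  simp only [Fintype.sum_sum_type, Fintype.sum_sigma, Finset.univ_unique, Finset.sum_singleton,
    PUnit.default_eq_unit, h0, h1, h2, h3, h4, h5, h6, h7, h8, h1', h2', h3', h5', h7',
    if_true, if_false, Finset.sum_const_zero, add_zero, zero_add, Finset.sum_add_distrib,
    Finset.sum_ite_irrel, Finset.sum_ite_eq, Finset.sum_ite_eq', Finset.mem_univ]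
  simp only [sub_sq_comm _ (x (.inl ())),
    sub_sq_comm (x (.inr (.inr ⟨_, .inr _⟩))) (x (.inr (.inr ⟨_, .inl ()⟩)))]
  ring

/-- The triangular change of variables that diagonalizes the quadratic form of `diam4Tree`. -/
noncomputable def diam4TreeShift (p r : ℕ) (s : Fin r → ℕ) (α : ℝ) (a : Fin r → ℝ) :
    (Unit ⊕ (Fin p ⊕ (Σ i : Fin r, Unit ⊕ Fin (s i))) → ℝ) →ₗ[ℝ]
      (Unit ⊕ (Fin p ⊕ (Σ i : Fin r, Unit ⊕ Fin (s i))) → ℝ) where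
  toFun x
    | .inl _ => x (.inl ())
    | .inr (.inl j) => x (.inr (.inl j)) - x (.inl ()) / α
    | .inr (.inr ⟨i, .inl _⟩) => x (.inr (.inr ⟨i, .inl ()⟩)) - x (.inl ()) / a i
    | .inr (.inr ⟨i, .inr j⟩) => x (.inr (.inr ⟨i, .inr j⟩)) - x (.inr (.inr ⟨i, .inl ()⟩)) / α
  map_add' x y := by
    ext (_ | _ | ⟨i, _ | _⟩) <;> simp only [Pi.add_apply] <;> ring
  map_smul' c x := by
    ext (_ | _ | ⟨i, _ | _⟩) <;> simp only [Pi.smul_apply, smul_eq_mul, RingHom.id_apply] <;> ring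

theorem diam4TreeShift_injective (p r : ℕ) (s : Fin r → ℕ) (α : ℝ) (a : Fin r → ℝ) :
    Function.Injective (diam4TreeShift p r s α a) := by
  rw [← LinearMap.ker_eq_bot, LinearMap.ker_eq_bot']
  intro x hx
  have h0 : x (.inl ()) = 0 := congrFun hx (.inl ())
  have h1 : ∀ i, x (.inr (.inr ⟨i, .inl ()⟩)) = 0 := fun i => by
    have h : x (.inr (.inr ⟨i, .inl ()⟩)) - x (.inl ()) / a i = 0 :=
      congrFun hx (.inr (.inr ⟨i, .inl ()⟩))
    simpa [h0] using h
  ext (_ | j | ⟨i, _ | j⟩)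
  · exact h0
  · have h : x (.inr (.inl j)) - x (.inl ()) / α = 0 := congrFun hx (.inr (.inl j))
    simpa [h0] using h
  · exact h1 i
  · have h : x (.inr (.inr ⟨i, .inr j⟩)) - x (.inr (.inr ⟨i, .inl ()⟩)) / α = 0 :=
      congrFun hx (.inr (.inr ⟨i, .inr j⟩))
    simpa [h1] using h

/-- The pivots of the quadratic form of `diam4Tree` after `diam4TreeShift`: `b` at the root, `α`
at the leaves and `a i` at the `i`-th neighbour of the root. -/
def diam4TreeWeight (p r : ℕ) (s : Fin r → ℕ) (b α : ℝ) (a : Fin r → ℝ) :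
    Unit ⊕ (Fin p ⊕ (Σ i : Fin r, Unit ⊕ Fin (s i))) → ℝ
  | .inl _ => b
  | .inr (.inl _) => α
  | .inr (.inr ⟨i, .inl _⟩) => a i
  | .inr (.inr ⟨_, .inr _⟩) => α

theorem diam4Tree_quadratic_sub_eq_sum (p r : ℕ) (s : Fin r → ℕ) (c α b : ℝ) (a : Fin r → ℝ)
    (hα : α = 1 - c) (hα0 : α ≠ 0) (ha : ∀ i, a i = 1 - c + s i * (1 - 1 / α))
    (ha0 : ∀ i, a i ≠ 0) (hb : b = -c + p * (1 - 1 / α) + ∑ i, (1 - 1 / a i))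
    (x : Unit ⊕ (Fin p ⊕ (Σ i : Fin r, Unit ⊕ Fin (s i))) → ℝ) :
    x ⬝ᵥ (diam4Tree p r s).lapMatrix ℝ *ᵥ x - c * (x ⬝ᵥ x) =
      ∑ v, diam4TreeWeight p r s b α a v * (diam4TreeShift p r s α a x v) ^ 2 := by
  have leaf : ∀ y z : ℝ, α * (z - y / α) ^ 2 = (y - z) ^ 2 - c * z ^ 2 - (1 - 1 / α) * y ^ 2 := by
    intro y z
    have : c = 1 - α := by linarith
    subst this
    field_simp
    ring
  have nbr : ∀ i, ∀ y z : ℝ, a i * (z - y / a i) ^ 2 =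
      (y - z) ^ 2 - c * z ^ 2 + s i * ((1 - 1 / α) * z ^ 2) - (1 - 1 / a i) * y ^ 2 := by
    intro i y z
    have h : a i * (z - y / a i) ^ 2 = a i * z ^ 2 - 2 * y * z + y ^ 2 / a i := by
      have := ha0 i
      field_simp
      ring
    rw [h]
    linear_combination z ^ 2 * ha i
  rw [diam4Tree_quadratic]
  simp only [dotProduct, Fintype.sum_sum_type, Fintype.sum_sigma, Finset.univ_unique,
    Finset.sum_singleton, PUnit.default_eq_unit, diam4TreeWeight, diam4TreeShift,
    LinearMap.coe_mk, AddHom.coe_mk, leaf, nbr, ← pow_two]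
  simp only [Finset.sum_sub_distrib, Finset.sum_add_distrib, Finset.sum_const, Finset.card_univ,
    Fintype.card_fin, nsmul_eq_mul, ← Finset.mul_sum, ← Finset.sum_mul, hb]
  ring

theorem ncard_diam4TreeWeight_pos (p r : ℕ) (s : Fin r → ℕ) (b α : ℝ) (a : Fin r → ℝ)
    (hα : α < 0) (ha : ∀ i, 0 < a i) :
    {v | 0 < diam4TreeWeight p r s b α a v}.ncard = r + if 0 < b then 1 else 0 := by
  classical
  rw [Set.ncard_eq_toFinset_card', Set.toFinset_ofPred, Finset.card_filter]
  simp [Fintype.sum_sum_type, Fintype.sum_sigma, diam4TreeWeight, hα.not_gt, ha, add_comm]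
  congr

/-- Let `T` be the diameter-4 tree whose root is adjacent to `p ≥ 0` leaves
and to `r ≥ 2` vertices `v₁, …, v_r`, where `v_i` is additionally adjacent to `s_i ≥ 1`
leaves, and let `n = 1 + p + r + s₁ + ⋯ + s_r`. If `σ` is the number of Laplacian
eigenvalues of `T` strictly larger than the average degree `2 - 2/n`, then `σ = r` or
`σ = r + 1`; moreover, if `p ≥ 1` or at least three of the `s_i` satisfy `s_i ≥ 2`,
then `σ = r + 1`. -/
theorem sigma_diam4Tree (p r : ℕ) (hr : 2 ≤ r) (s : Fin r → ℕ) (hs : ∀ i, 1 ≤ s i)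
    (n : ℕ) (hn : n = 1 + p + r + ∑ i, s i) (σ : ℕ)
    (hσ : σ = Multiset.card
      ((lapSpectrum (diam4Tree p r s)).filter (fun x => 2 - 2 / (n : ℝ) < x))) :
    (σ = r ∨ σ = r + 1) ∧
    ((1 ≤ p ∨ 3 ≤ (Finset.univ.filter (fun i => 2 ≤ s i)).card) → σ = r + 1) := by
  have hn5 : (5 : ℝ) ≤ n := by
    have h : r ≤ ∑ i, s i := by
      simpa using Finset.sum_le_sum fun i (_ : i ∈ Finset.univ) => hs i
    exact_mod_cast (by omega : 5 ≤ n)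
  set c : ℝ := 2 - 2 / (n : ℝ) with hc
  have h2n : 0 < 2 / (n : ℝ) := by positivity
  have h2n' : 2 / (n : ℝ) < 1 := by rw [div_lt_one (by linarith)]; linarith
  set α : ℝ := 1 - c with hα
  have hα0 : α < 0 := by linarith
  have hα1 : -1 < α := by linarith
  have hinv : 1 / α < -1 := by
    rw [div_lt_iff_of_neg hα0]; linarith
  let a : Fin r → ℝ := fun i => 1 - c + s i * (1 - 1 / α)
  have has : ∀ i, 2 * (s i : ℝ) - 1 < a i := fun i => by
    have : (1 : ℝ) ≤ s i := by exact_mod_cast hs i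
    change 2 * (s i : ℝ) - 1 < α + s i * (1 - 1 / α)
    nlinarith
  have ha1 : ∀ i, 1 < a i := fun i => by
    have : (1 : ℝ) ≤ s i := by exact_mod_cast hs i
    linarith [has i]
  have ha0 : ∀ i, 0 < a i := fun i => by linarith [ha1 i]
  have hterm : ∀ i, 0 ≤ 1 - 1 / a i := fun i => by
    rw [sub_nonneg, div_le_one (ha0 i)]; exact (ha1 i).le
  let b : ℝ := -c + p * (1 - 1 / α) + ∑ i, (1 - 1 / a i)
  have hcard : σ = r + if 0 < b then 1 else 0 := by
    rw [hσ, ← ncard_diam4TreeWeight_pos p r s b α a hα0 ha0]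
    exact card_charpoly_roots_gt_eq_ncard
      (SimpleGraph.posSemidef_lapMatrix ℝ (diam4Tree p r s)).isHermitian c _
      (diam4TreeShift p r s α a) (diam4TreeShift_injective p r s α a)
      (diam4Tree_quadratic_sub_eq_sum p r s c α b a rfl hα0.ne (fun _ => rfl)
        (fun i => (ha0 i).ne') rfl)
  refine ⟨by split_ifs at hcard <;> simp [hcard], fun h => ?_⟩
  suffices hb : 0 < b by rw [hcard, if_pos hb]
  rcases h with hp | h3
  · have hp' : (1 : ℝ) ≤ p := by exact_mod_cast hp
    have := Finset.sum_nonneg fun i (_ : i ∈ Finset.univ) => hterm i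
    change 0 < -c + p * (1 - 1 / α) + ∑ i, (1 - 1 / a i)
    nlinarith
  · set S := Finset.univ.filter (fun i => 2 ≤ s i) with hS
    have h1 : ∑ i ∈ S, (2 / 3 : ℝ) ≤ ∑ i ∈ S, (1 - 1 / a i) :=
      Finset.sum_le_sum fun i hi => by
        have hi2 : (2 : ℝ) ≤ s i := by exact_mod_cast (Finset.mem_filter.mp hi).2
        have h3a : 1 / a i ≤ 1 / 3 := one_div_le_one_div_of_le (by norm_num) (by linarith [has i])
        linarith
    have h2 : ∑ i ∈ S, (1 - 1 / a i) ≤ ∑ i, (1 - 1 / a i) :=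
      Finset.sum_le_sum_of_subset_of_nonneg (Finset.filter_subset _ _) fun i _ _ => hterm i
    have h3' : (3 : ℝ) ≤ S.card := by exact_mod_cast h3
    have h4 : 0 ≤ (p : ℝ) * (1 - 1 / α) := mul_nonneg (by positivity) (by linarith)
    rw [Finset.sum_const, nsmul_eq_mul] at h1
    change 0 < -c + p * (1 - 1 / α) + ∑ i, (1 - 1 / a i)
    linarith

end LapPaper
end

section
/- Every tree T with n vertices satisfies S_k(T) ≤ n − 2 + 2k − (2k − 2)/n for every integer k with 1 ≤ k ≤ n. -/
open Polynomial

namespace LapPaper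

section Spectral

open Matrix Finset

variable {V : Type} [Fintype V]

/-- The form `x ↦ xᵀ (w wᵀ) x` is the square of `w ⬝ᵥ x`. -/
lemma dotProduct_vecMulVec_self_mulVec (w x : V → ℝ) :
    x ⬝ᵥ vecMulVec w w *ᵥ x = (w ⬝ᵥ x) ^ 2 := by
  rw [vecMulVec_mulVec]
  simp [dotProduct_comm x w, sq]

lemma posSemidef_vecMulVec_self (w : V → ℝ) : (vecMulVec w w).PosSemidef := by
  simpa using posSemidef_vecMulVec_self_star w

/-- The trace of a matrix is the sum of its quadratic form over an orthonormal eigenbasis of a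
symmetric matrix. -/
lemma sum_eigenvectorBasis_dotProduct_mulVec [DecidableEq V] {A : Matrix V V ℝ} (hA : A.IsHermitian)
    (Z : Matrix V V ℝ) :
    ∑ i, (hA.eigenvectorBasis i : V → ℝ) ⬝ᵥ Z *ᵥ (hA.eigenvectorBasis i : V → ℝ) = Z.trace := by
  set U : Matrix V V ℝ := ↑hA.eigenvectorUnitary with hU
  have h1 : (star U * Z * U).trace = Z.trace := by
    rw [trace_mul_cycle, mem_unitaryGroup_iff.1 hA.eigenvectorUnitary.2, one_mul]
  rw [← h1, Matrix.trace]
  refine Finset.sum_congr rfl fun i _ => ?_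
  rw [diag_apply, mul_assoc, mul_apply, dotProduct]
  refine Finset.sum_congr rfl fun j _ => ?_
  rw [mul_apply]
  simp [hU, mulVec, dotProduct, star_apply]

/-- If `L(G) - c` is dominated by a positive semidefinite matrix `Z`, then
`S_k(G) ≤ c k + tr Z`. -/
theorem Sk_le_of_posSemidef [DecidableEq V] (G : SimpleGraph V) [DecidableRel G.Adj] {Z : Matrix V V ℝ}
    (hZ : Z.PosSemidef) {c : ℝ} (hc : 0 ≤ c)
    (h : ∀ x : V → ℝ, x ⬝ᵥ G.lapMatrix ℝ *ᵥ x - c * (x ⬝ᵥ x) ≤ x ⬝ᵥ Z *ᵥ x) (k : ℕ) :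
    Sk G k ≤ c * k + Z.trace := by
  have hL : (G.lapMatrix ℝ).IsHermitian := G.isHermitian_lapMatrix ℝ
  set l : List ℝ := ((lapSpectrum G).sort (· ≤ ·)).reverse with hl
  have hl' : (l : Multiset ℝ) = univ.val.map hL.eigenvalues := by
    have : lapSpectrum G = univ.val.map hL.eigenvalues := by
      rw [lapSpectrum, hL.roots_charpoly_eq_eigenvalues]
      rfl
    rw [hl, Multiset.coe_reverse, Multiset.sort_eq, this]
  have hpos : ∑ i, max (hL.eigenvalues i - c) 0 ≤ Z.trace := by
    rw [← sum_eigenvectorBasis_dotProduct_mulVec hL Z]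
    refine Finset.sum_le_sum fun i _ => max_le ?_ ?_
    · have hu : (hL.eigenvectorBasis i : V → ℝ) ⬝ᵥ (hL.eigenvectorBasis i : V → ℝ) = 1 := by
        have := hL.eigenvectorBasis.orthonormal.1 i
        rw [EuclideanSpace.norm_eq, Real.sqrt_eq_one] at this
        simpa [dotProduct, sq] using this
      have := h (hL.eigenvectorBasis i)
      rw [hL.mulVec_eigenvectorBasis, dotProduct_smul, hu] at this
      simpa using this
    · simpa using hZ.dotProduct_mulVec_nonneg (hL.eigenvectorBasis i : V → ℝ)
  have hsplit : ∀ s : List ℝ, s.sum ≤ c * s.length + (s.map fun y => max (y - c) 0).sum := by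
    intro s
    induction s with
    | nil => simp
    | cons y s ih =>
      have := le_max_left (y - c) 0
      simp only [List.sum_cons, List.length_cons, List.map_cons]
      push_cast
      linarith
  have hsub : ((l.take k).map fun y => max (y - c) 0).sum ≤ (l.map fun y => max (y - c) 0).sum :=
    ((List.take_sublist k l).map _).sum_le_sum fun y hy => by
      obtain ⟨z, -, rfl⟩ := List.mem_map.1 hy
      exact le_max_right _ _
  have htot : (l.map fun y => max (y - c) 0).sum = ∑ i, max (hL.eigenvalues i - c) 0 := by
    rw [← Multiset.sum_coe, ← Multiset.map_coe, hl', Multiset.map_map]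
    rfl
  have hlen : c * ((l.take k).length : ℝ) ≤ c * k := by
    gcongr
    exact List.length_take_le k l
  calc Sk G k = (l.take k).sum := rfl
    _ ≤ _ := hsplit _
    _ ≤ c * k + Z.trace := by linarith

end Spectral

section Splitting

open Finset

variable {V : Type}

/-- Any two vertices of `S` are joined by a walk of `G` inside `S`. -/
def ConnectedOn (G : SimpleGraph V) (S : Finset V) : Prop :=
  ∀ u ∈ S, ∀ v ∈ S, Relation.ReflTransGen (fun x y => G.Adj x y ∧ x ∈ S ∧ y ∈ S) u v

lemma connectedOn_of_forall_center {G : SimpleGraph V} {S : Finset V} {a : V}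
    (h : ∀ x ∈ S, Relation.ReflTransGen (fun x y => G.Adj x y ∧ x ∈ S ∧ y ∈ S) a x) :
    ConnectedOn G S := by
  intro u hu v hv
  have hsymm : Std.Symm (fun x y => G.Adj x y ∧ x ∈ S ∧ y ∈ S) :=
    ⟨fun x y hxy => ⟨hxy.1.symm, hxy.2.2, hxy.2.1⟩⟩
  exact (Std.Symm.symm _ _ (h u hu)).trans (h v hv)

/-- Removing an edge from a subtree splits it into two subtrees. -/
theorem exists_split_of_isAcyclic [DecidableEq V] {G : SimpleGraph V} (hG : G.IsAcyclic) {S : Finset V}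
    (hS : ConnectedOn G S) {a b : V} (ha : a ∈ S) (hb : b ∈ S) (hab : G.Adj a b) :
    ∃ A B : Finset V, Disjoint A B ∧ A ∪ B = S ∧ a ∈ A ∧ b ∈ B ∧ ConnectedOn G A ∧
      ConnectedOn G B ∧ ∀ u ∈ A, ∀ v ∈ B, G.Adj u v → u = a ∧ v = b := by
  classical
  let R : V → V → Prop := fun x y => G.Adj x y ∧ x ∈ S ∧ y ∈ S ∧ s(x, y) ≠ s(a, b)
  have hbridge : ¬ Relation.ReflTransGen R a b := by
    intro h
    have := (SimpleGraph.isAcyclic_iff_forall_adj_isBridge.1 hG) hab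
    rw [SimpleGraph.isBridge_iff, SimpleGraph.reachable_iff_reflTransGen] at this
    refine this (Relation.ReflTransGen.mono (fun x y hxy => ?_) _ _ h)
    rw [SimpleGraph.deleteEdges_adj]
    exact ⟨hxy.1, hxy.2.2.2⟩
  have hR : Std.Symm R := ⟨fun x y hxy =>
    ⟨hxy.1.symm, hxy.2.2.1, hxy.2.1, by rw [Sym2.eq_swap]; exact hxy.2.2.2⟩⟩
  have hcover : ∀ x ∈ S, Relation.ReflTransGen R a x ∨ Relation.ReflTransGen R b x := by
    intro x hx
    induction hS a ha x hx with
    | refl => exact Or.inl .refl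
    | @tail y z _ hyz ih =>
      by_cases he : s(y, z) = s(a, b)
      · rcases Sym2.eq_iff.1 he with ⟨-, rfl⟩ | ⟨-, rfl⟩
        · exact Or.inr .refl
        · exact Or.inl .refl
      · exact (ih hyz.2.1).imp (·.tail ⟨hyz.1, hyz.2.1, hyz.2.2, he⟩)
          (·.tail ⟨hyz.1, hyz.2.1, hyz.2.2, he⟩)
  have hinside : ∀ (p : V) (C : Finset V), (∀ y ∈ S, Relation.ReflTransGen R p y → y ∈ C) →
      ∀ x, Relation.ReflTransGen R p x →
        Relation.ReflTransGen (fun x y => G.Adj x y ∧ x ∈ C ∧ y ∈ C) p x := by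
    intro p C hC x hx
    induction hx with
    | refl => exact .refl
    | @tail y z hy hyz ih =>
      exact ih.tail ⟨hyz.1, hC y hyz.2.1 hy, hC z hyz.2.2.1 (hy.tail hyz)⟩
  have hnot : ∀ y, Relation.ReflTransGen R b y → ¬ Relation.ReflTransGen R a y :=
    fun y hy hay => hbridge (hay.trans (Std.Symm.symm _ _ hy))
  refine ⟨S.filter (Relation.ReflTransGen R a), S.filter (¬ Relation.ReflTransGen R a ·),
    disjoint_filter_filter_not _ _ _, filter_union_filter_not_eq _ _, ?_, ?_, ?_, ?_, ?_⟩
  · simp [ha, Relation.ReflTransGen.refl]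
  · simp [hb, hbridge]
  · refine connectedOn_of_forall_center (a := a) fun x hx => hinside a _ ?_ x (mem_filter.1 hx).2
    exact fun y hy hay => mem_filter.2 ⟨hy, hay⟩
  · refine connectedOn_of_forall_center (a := b) fun x hx => hinside b _ ?_ x ?_
    · exact fun y hy hby => mem_filter.2 ⟨hy, hnot y hby⟩
    · rw [mem_filter] at hx
      exact (hcover x hx.1).resolve_left hx.2
  · intro u hu v hv huv
    rw [mem_filter] at hu hv
    by_cases he : s(u, v) = s(a, b)
    · rcases Sym2.eq_iff.1 he with h | ⟨rfl, -⟩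
      · exact h
      · exact absurd hu.2 hbridge
    · exact absurd (hu.2.tail ⟨huv, hu.1, hv.1, he⟩) hv.2

/-- A connected set of at least two vertices in which every edge has an end without further
neighbours spans a star. -/
theorem exists_star_center {G : SimpleGraph V} {S : Finset V} (hS : ConnectedOn G S)
    (hcard : 2 ≤ #S)
    (hleaf : ∀ a ∈ S, ∀ b ∈ S, G.Adj a b →
      (∀ x ∈ S, G.Adj a x → x = b) ∨ (∀ x ∈ S, G.Adj b x → x = a)) :
    ∃ r ∈ S, ∀ u ∈ S, ∀ v ∈ S, G.Adj u v ↔ (u = r ∧ v ≠ r) ∨ (v = r ∧ u ≠ r) := by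
  obtain ⟨p, hp, q, hq, hpq, hqp⟩ : ∃ p ∈ S, ∃ q ∈ S, G.Adj p q ∧ ∀ x ∈ S, G.Adj q x → x = p := by
    obtain ⟨u, hu, v, hv, huv⟩ := one_lt_card.1 hcard
    obtain rfl | ⟨w, huw, -⟩ := (hS u hu v hv).cases_head
    · exact absurd rfl huv
    · rcases hleaf u hu w huw.2.2 huw.1 with h | h
      · exact ⟨w, huw.2.2, u, hu, huw.1.symm, h⟩
      · exact ⟨u, hu, w, huw.2.2, huw.1, h⟩
  have honly : ∀ x ∈ S, G.Adj p x → ∀ y ∈ S, G.Adj x y → y = p := by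
    intro x hx hpx y hy hxy
    rcases hleaf p hp x hx hpx with h | h
    · obtain rfl := h q hq hpq
      exact hqp y hy hxy
    · exact h y hy hxy
  have hall : ∀ x ∈ S, x = p ∨ G.Adj p x := by
    intro x hx
    induction hS p hp x hx with
    | refl => exact Or.inl rfl
    | @tail y z _ hyz ih =>
      rcases ih hyz.2.1 with rfl | hy
      · exact Or.inr hyz.1
      · exact Or.inl (honly y hyz.2.1 hy z hyz.2.2 hyz.1)
  refine ⟨p, hp, fun u hu v hv => ⟨fun huv => ?_, ?_⟩⟩
  · rcases hall u hu with rfl | h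
    · exact Or.inl ⟨rfl, huv.ne'⟩
    · exact Or.inr ⟨honly u hu h v hv huv, h.ne'⟩
  · rintro (⟨rfl, h⟩ | ⟨rfl, h⟩)
    · exact (hall v hv).resolve_left h
    · exact ((hall u hu).resolve_left h).symm

end Splitting

section Domination

open Matrix Finset

variable {V : Type}

/-- The Laplacian quadratic form of the subgraph of `G` induced on `S`. -/
noncomputable def energyOn (G : SimpleGraph V) [DecidableRel G.Adj] (S : Finset V) (x : V → ℝ) :
    ℝ :=
  (∑ u ∈ S, ∑ v ∈ S, if G.Adj u v then (x u - x v) ^ 2 else 0) / 2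

lemma energyOn_star [DecidableEq V] {G : SimpleGraph V} [DecidableRel G.Adj] {S : Finset V} {r : V}
    (hr : r ∈ S)
    (hstar : ∀ u ∈ S, ∀ v ∈ S, G.Adj u v ↔ (u = r ∧ v ≠ r) ∨ (v = r ∧ u ≠ r)) (x : V → ℝ) :
    energyOn G S x = ∑ u ∈ S, x u ^ 2 - 2 * x r * ∑ u ∈ S, x u + #S * x r ^ 2 := by
  have hterm : ∀ u ∈ S, ∀ v ∈ S, (if G.Adj u v then (x u - x v) ^ 2 else 0) =
      (if u = r then (x r - x v) ^ 2 else 0) + (if v = r then (x r - x u) ^ 2 else 0) := by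
    intro u hu v hv
    have := hstar u hu v hv
    by_cases h1 : u = r <;> by_cases h2 : v = r <;> simp_all
    ring
  have hsq : ∑ u ∈ S, (x r - x u) ^ 2 =
      ∑ u ∈ S, x u ^ 2 - 2 * x r * ∑ u ∈ S, x u + #S * x r ^ 2 := by
    simp only [sub_sq, sum_add_distrib, sum_sub_distrib, ← mul_sum, sum_const, nsmul_eq_mul]
    ring
  rw [energyOn, sum_congr rfl fun u hu => sum_congr rfl (hterm u hu)]
  simp only [sum_add_distrib]
  rw [sum_comm]
  simp only [sum_ite_eq', hr, if_true, hsq]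
  ring

lemma energyOn_union [DecidableEq V] {G : SimpleGraph V} [DecidableRel G.Adj] {A B : Finset V}
    (hAB : Disjoint A B) {a b : V} (ha : a ∈ A) (hb : b ∈ B) (hab : G.Adj a b)
    (hcross : ∀ u ∈ A, ∀ v ∈ B, G.Adj u v → u = a ∧ v = b) (x : V → ℝ) :
    energyOn G (A ∪ B) x = energyOn G A x + energyOn G B x + (x a - x b) ^ 2 := by
  have h1 : ∑ u ∈ A, ∑ v ∈ B, (if G.Adj u v then (x u - x v) ^ 2 else 0) = (x a - x b) ^ 2 := by
    rw [sum_eq_single_of_mem a ha, sum_eq_single_of_mem b hb, if_pos hab]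
    · exact fun v hv hne => if_neg fun h => hne (hcross a ha v hv h).2
    · exact fun u hu hne => sum_eq_zero fun v hv => if_neg fun h => hne (hcross u hu v hv h).1
  have h2 : ∑ u ∈ B, ∑ v ∈ A, (if G.Adj u v then (x u - x v) ^ 2 else 0) = (x a - x b) ^ 2 := by
    rw [sum_comm, ← h1]
    refine sum_congr rfl fun u _ => sum_congr rfl fun v _ => ?_
    simp only [G.adj_comm v u]
    congr 1
    ring
  simp only [energyOn, sum_union hAB, sum_add_distrib, h1, h2]
  ring

variable [Fintype V] [DecidableEq V]

lemma exists_posSemidef_of_star {G : SimpleGraph V} [DecidableRel G.Adj] {S : Finset V} {r : V}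
    (hr : r ∈ S)
    (hstar : ∀ u ∈ S, ∀ v ∈ S, G.Adj u v ↔ (u = r ∧ v ≠ r) ∨ (v = r ∧ u ≠ r))
    (hcard : 2 ≤ #S) {t : ℝ} (ht0 : 0 ≤ t) (ht1 : t ≤ 1) :
    ∃ Z : Matrix V V ℝ, Z.PosSemidef ∧ Z.trace ≤ #S - 2 + t ∧ ∀ x : V → ℝ,
      energyOn G S x - (2 - t) * ∑ u ∈ S, x u ^ 2 + (2 - t) * (∑ u ∈ S, x u) ^ 2 / #S ≤
        x ⬝ᵥ Z *ᵥ x := by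
  set m : ℝ := (#S : ℝ) with hm
  have hm2 : (2 : ℝ) ≤ m := by rw [hm]; exact_mod_cast hcard
  let w : V → ℝ := fun u => (if u = r then m else 0) - if u ∈ S then 1 else 0
  have hw : ∀ x : V → ℝ, w ⬝ᵥ x = m * x r - ∑ u ∈ S, x u := by
    intro x
    simp [w, dotProduct, sub_mul, sum_sub_distrib]
  have hww : w ⬝ᵥ w = m * (m - 1) := by
    have hwr : w r = m - 1 := by simp [w, hr]
    have hws : ∑ u ∈ S, w u = 0 := by simp [w, hr, hm]
    rw [hw, hwr, hws, sub_zero]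
  refine ⟨((m - 2 + t) / (m * (m - 1))) • vecMulVec w w,
    (posSemidef_vecMulVec_self w).smul (by apply div_nonneg <;> nlinarith), ?_, fun x => ?_⟩
  · rw [trace_smul, trace_vecMulVec, hww, smul_eq_mul, div_mul_cancel₀]
    nlinarith
  · rw [smul_mulVec, dotProduct_smul, dotProduct_vecMulVec_self_mulVec, hw, smul_eq_mul,
      energyOn_star hr hstar]
    have hcs : (∑ u ∈ S, x u - x r) ^ 2 ≤ (m - 1) * (∑ u ∈ S, x u ^ 2 - x r ^ 2) := by
      have h := sq_sum_le_card_mul_sum_sq (s := S.erase r) (f := x)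
      rwa [sum_erase_eq_sub hr, sum_erase_eq_sub hr, card_erase_of_mem hr,
        Nat.cast_sub (by omega), Nat.cast_one, ← hm] at h
    generalize ∑ u ∈ S, x u = s at *
    generalize ∑ u ∈ S, x u ^ 2 = q at *
    generalize x r = y at *
    have hm1 : 0 < m - 1 := by linarith
    have key : (m - 2 + t) / (m * (m - 1)) * (m * y - s) ^ 2 -
        (q - 2 * y * s + m * y ^ 2 - (2 - t) * q + (2 - t) * s ^ 2 / m) =
        (1 - t) * ((m - 1) * (q - y ^ 2) - (s - y) ^ 2) / (m - 1) := by
      field_simp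
      ring
    have : 0 ≤ (1 - t) * ((m - 1) * (q - y ^ 2) - (s - y) ^ 2) / (m - 1) :=
      div_nonneg (mul_nonneg (by linarith) (by linarith)) hm1.le
    linarith

/-- Joining two disjoint subtrees by an edge costs at most `2 - t` in the trace of a dominating
positive semidefinite matrix. -/
lemma exists_posSemidef_of_union {A B : Finset V} (hAB : Disjoint A B) {a b : V} (ha : a ∈ A)
    (hb : b ∈ B) (hA : 2 ≤ #A) (hB : 2 ≤ #B) {t : ℝ} (ht : t * #(A ∪ B) ≤ 2) :
    ∃ W : Matrix V V ℝ, W.PosSemidef ∧ W.trace ≤ 2 - t ∧ ∀ x : V → ℝ,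
      (x a - x b) ^ 2 + (2 - t) * (∑ u ∈ A ∪ B, x u) ^ 2 / #(A ∪ B) -
        (2 - t) * (∑ u ∈ A, x u) ^ 2 / #A - (2 - t) * (∑ u ∈ B, x u) ^ 2 / #B ≤
        x ⬝ᵥ W *ᵥ x := by
  rw [card_union_of_disjoint hAB, Nat.cast_add] at *
  have haB : a ∉ B := disjoint_left.1 hAB ha
  have hbA : b ∉ A := disjoint_right.1 hAB hb
  have hab : a ≠ b := fun h => haB (h ▸ hb)
  set p : ℝ := (#A : ℝ) with hp
  set q : ℝ := (#B : ℝ) with hq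
  have hp2 : (2 : ℝ) ≤ p := by rw [hp]; exact_mod_cast hA
  have hq2 : (2 : ℝ) ≤ q := by rw [hq]; exact_mod_cast hB
  have hp0 : 0 < p := by linarith
  have hq0 : 0 < q := by linarith
  obtain ⟨d, hd⟩ : ∃ d : ℝ, d = (p + q) / (2 * (p * q)) := ⟨_, rfl⟩
  have hd0 : 0 < d := by
    rw [hd]
    positivity
  have hd1 : d ≤ 1 := by
    rw [hd, div_le_one (by positivity)]
    nlinarith
  have htd : t ≤ d := by
    rw [hd, le_div_iff₀ (by positivity)]
    have h : t ≤ 2 / (p + q) := (le_div_iff₀ (by positivity)).2 ht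
    calc t * (2 * (p * q)) ≤ 2 / (p + q) * (2 * (p * q)) := by gcongr
      _ ≤ p + q := by
        rw [div_mul_eq_mul_div, div_le_iff₀ (by positivity)]
        nlinarith [sq_nonneg (p - q)]
  have hden : 0 < 4 - 3 * d := by linarith
  have hinv : 1 / p + 1 / q = 2 * d := by
    rw [hd]
    field_simp
    ring
  let w : V → ℝ := fun u => (if u = a then 2 else 0) - (if u = b then 2 else 0) -
    (if u ∈ A then 1 / p else 0) + if u ∈ B then 1 / q else 0
  have hw : ∀ x : V → ℝ,
      w ⬝ᵥ x = 2 * (x a - x b) - ((∑ u ∈ A, x u) / p - (∑ u ∈ B, x u) / q) := by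
    intro x
    simp only [w, dotProduct, sub_mul, add_mul, ite_mul, zero_mul, sum_sub_distrib,
      sum_add_distrib, sum_ite_eq', sum_ite_mem, mem_univ, if_true, univ_inter, ← mul_sum]
    ring
  have hwA : ∑ u ∈ A, w u = 1 := by
    have h : ∀ u ∈ A, w u = (if u = a then 2 else 0) - 1 / p := by
      intro u hu
      have h1 : u ≠ b := fun h => hbA (h ▸ hu)
      simp [w, hu, h1, disjoint_left.1 hAB hu]
    rw [sum_congr rfl h, sum_sub_distrib, sum_ite_eq', if_pos ha, sum_const, nsmul_eq_mul, ← hp]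
    field_simp
    norm_num
  have hwB : ∑ u ∈ B, w u = -1 := by
    have h : ∀ u ∈ B, w u = 1 / q - (if u = b then 2 else 0) := by
      intro u hu
      have h1 : u ≠ a := fun h => haB (h ▸ hu)
      simp only [w, hu, h1, disjoint_right.1 hAB hu, if_true, if_false]
      ring
    rw [sum_congr rfl h, sum_sub_distrib, sum_ite_eq', if_pos hb, sum_const, nsmul_eq_mul, ← hq]
    field_simp
    norm_num
  have hww : w ⬝ᵥ w = 2 * (4 - 3 * d) := by
    have h1 : w a = 2 - 1 / p := by simp [w, ha, haB, hab]
    have h2 : w b = 1 / q - 2 := by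
      simp only [w, hb, hbA, hab.symm, if_true, if_false]
      ring
    rw [hw, hwA, hwB, h1, h2]
    linear_combination (-3) * hinv
  refine ⟨((2 - d) / (2 * (4 - 3 * d))) • vecMulVec w w,
    (posSemidef_vecMulVec_self w).smul (div_nonneg (by linarith) (by linarith)), ?_, fun x => ?_⟩
  · rw [trace_smul, trace_vecMulVec, hww, smul_eq_mul, div_mul_cancel₀ _ (by positivity)]
    linarith
  · rw [smul_mulVec, dotProduct_smul, dotProduct_vecMulVec_self_mulVec, hw, smul_eq_mul,
      sum_union hAB]
    generalize ∑ u ∈ A, x u = y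
    generalize ∑ u ∈ B, x u = z
    generalize x a - x b = s
    set g : ℝ := y / p - z / q with hg
    have hproj : (2 - t) * (y + z) ^ 2 / (p + q) - (2 - t) * y ^ 2 / p - (2 - t) * z ^ 2 / q =
        -((2 - t) * (g ^ 2 / (2 * d))) := by
      rw [hg, hd]
      field_simp
      ring
    have hmono : (2 - d) * (g ^ 2 / (2 * d)) ≤ (2 - t) * (g ^ 2 / (2 * d)) := by
      gcongr
    have key : (2 - d) / (2 * (4 - 3 * d)) * (2 * s - g) ^ 2 - s ^ 2 +
        (2 - d) * (g ^ 2 / (2 * d)) = (d * s - (2 - d) * g) ^ 2 / (d * (4 - 3 * d)) := by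
      obtain ⟨e, he⟩ : ∃ e, e = 4 - 3 * d := ⟨_, rfl⟩
      rw [← he] at hden ⊢
      field_simp
      rw [he]
      ring
    have : 0 ≤ (d * s - (2 - d) * g) ^ 2 / (d * (4 - 3 * d)) := by positivity
    linarith

/-- The Laplacian form of a subtree on `S`, shifted by `2 - t` off the constant vectors, is
dominated by a positive semidefinite matrix of trace at most `#S - 2 + t`. -/
theorem exists_posSemidef_of_connectedOn {G : SimpleGraph V} [DecidableRel G.Adj]
    (hG : G.IsAcyclic) {t : ℝ} (ht0 : 0 ≤ t) (S : Finset V) (hS : ConnectedOn G S)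
    (hcard : 2 ≤ #S) (ht : t * #S ≤ 2) :
    ∃ Z : Matrix V V ℝ, Z.PosSemidef ∧ Z.trace ≤ #S - 2 + t ∧ ∀ x : V → ℝ,
      energyOn G S x - (2 - t) * ∑ u ∈ S, x u ^ 2 + (2 - t) * (∑ u ∈ S, x u) ^ 2 / #S ≤
        x ⬝ᵥ Z *ᵥ x := by
  induction S using Finset.strongInduction with
  | H S ih =>
    by_cases hleaf : ∀ a ∈ S, ∀ b ∈ S, G.Adj a b →
        (∀ x ∈ S, G.Adj a x → x = b) ∨ (∀ x ∈ S, G.Adj b x → x = a)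
    · obtain ⟨r, hr, hstar⟩ := exists_star_center hS hcard hleaf
      have : (2 : ℝ) ≤ #S := by exact_mod_cast hcard
      exact exists_posSemidef_of_star hr hstar hcard ht0 (by nlinarith)
    · push Not at hleaf
      obtain ⟨a, ha, b, hb, hab, ⟨a', ha', haa', hne⟩, b', hb', hbb', hne'⟩ := hleaf
      obtain ⟨A, B, hAB, rfl, haA, hbB, hA, hB, hcross⟩ := exists_split_of_isAcyclic hG hS ha hb hab
      have ha'A : a' ∈ A := (mem_union.1 ha').resolve_right fun h => hne (hcross a haA a' h haa').2
      have hb'B : b' ∈ B :=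
        (mem_union.1 hb').resolve_left fun h => hne' (hcross b' h b hbB hbb'.symm).1
      have hA2 : 2 ≤ #A := one_lt_card.2 ⟨a, haA, a', ha'A, haa'.ne⟩
      have hB2 : 2 ≤ #B := one_lt_card.2 ⟨b, hbB, b', hb'B, hbb'.ne⟩
      have hcA : (#A : ℝ) ≤ #(A ∪ B) := by exact_mod_cast card_le_card subset_union_left
      have hcB : (#B : ℝ) ≤ #(A ∪ B) := by exact_mod_cast card_le_card subset_union_right
      have hssA : A ⊂ A ∪ B := Finset.ssubset_iff_subset_ne.2
        ⟨subset_union_left, fun h => disjoint_right.1 hAB hbB (h ▸ hb)⟩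
      have hssB : B ⊂ A ∪ B := Finset.ssubset_iff_subset_ne.2
        ⟨subset_union_right, fun h => disjoint_left.1 hAB haA (h ▸ ha)⟩
      obtain ⟨Z₁, hZ₁, htr₁, hx₁⟩ := ih A hssA hA hA2 (by nlinarith)
      obtain ⟨Z₂, hZ₂, htr₂, hx₂⟩ := ih B hssB hB hB2 (by nlinarith)
      obtain ⟨W, hW, htrW, hxW⟩ := exists_posSemidef_of_union hAB haA hbB hA2 hB2 ht
      refine ⟨Z₁ + Z₂ + W, (hZ₁.add hZ₂).add hW, ?_, fun x => ?_⟩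
      · rw [trace_add, trace_add, card_union_of_disjoint hAB, Nat.cast_add]
        linarith
      · rw [add_mulVec, add_mulVec, dotProduct_add, dotProduct_add,
          energyOn_union hAB haA hbB hab hcross, sum_union hAB (f := fun u => x u ^ 2)]
        linarith [hx₁ x, hx₂ x, hxW x]

/-- The Laplacian form of a tree on `n` vertices, shifted by its average degree, is dominated by
a positive semidefinite matrix of trace at most `n - 2 + 2 / n`. -/
theorem exists_posSemidef_of_isTree {T : SimpleGraph V} [DecidableRel T.Adj] (hT : T.IsTree) :
    ∃ Z : Matrix V V ℝ, Z.PosSemidef ∧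
      Z.trace ≤ (Fintype.card V : ℝ) - 2 + 2 / Fintype.card V ∧
      ∀ x : V → ℝ, x ⬝ᵥ T.lapMatrix ℝ *ᵥ x - (2 - 2 / Fintype.card V) * (x ⬝ᵥ x) ≤
        x ⬝ᵥ Z *ᵥ x := by
  have hform : ∀ x : V → ℝ, x ⬝ᵥ T.lapMatrix ℝ *ᵥ x = energyOn T univ x := fun x => by
    rw [← toLinearMap₂'_apply', T.lapMatrix_toLinearMap₂' (R := ℝ), energyOn]
  have : Nonempty V := hT.connected.nonempty
  rcases Nat.lt_or_ge 1 (Fintype.card V) with hn | hn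
  · have hn0 : (0 : ℝ) < Fintype.card V := by exact_mod_cast Fintype.card_pos
    have hn2 : (2 : ℝ) ≤ Fintype.card V := by exact_mod_cast hn
    obtain ⟨Z, hZ, htr, hx⟩ := exists_posSemidef_of_connectedOn (t := 2 / Fintype.card V)
      hT.isAcyclic (by positivity) univ
      (fun u _ v _ => by
        simpa using (SimpleGraph.reachable_iff_reflTransGen u v).1 (hT.connected u v))
      hn (by rw [card_univ, div_mul_cancel₀ _ hn0.ne'])
    refine ⟨Z, hZ, htr, fun x => ?_⟩
    have hc : 2 / (Fintype.card V : ℝ) ≤ 2 := (div_le_iff₀ hn0).2 (by linarith)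
    have : 0 ≤ (2 - 2 / (Fintype.card V : ℝ)) * (∑ u, x u) ^ 2 / #(univ : Finset V) :=
      div_nonneg (mul_nonneg (by linarith) (sq_nonneg _)) (Nat.cast_nonneg _)
    have hxx : x ⬝ᵥ x = ∑ u, x u ^ 2 := by simp [dotProduct, sq]
    rw [hform, hxx]
    linarith [hx x]
  · have hn1 : Fintype.card V = 1 := le_antisymm hn Fintype.card_pos
    have : Subsingleton V := Fintype.card_le_one_iff_subsingleton.1 hn
    refine ⟨0, .zero, by norm_num [hn1], fun x => ?_⟩
    have h0 : energyOn T univ x = 0 := by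
      have : ∀ u v : V, x u - x v = 0 := fun u v => by rw [Subsingleton.elim u v, sub_self]
      simp [energyOn, this]
    simp [hform, h0, hn1]

end Domination

/-- Every tree `T` with `n` vertices satisfies
`S_k(T) ≤ n - 2 + 2k - (2k - 2)/n` for every `1 ≤ k ≤ n`. -/
theorem Sk_le_of_tree {V : Type} [Fintype V] [DecidableEq V]
    (T : SimpleGraph V) [DecidableRel T.Adj] (n : ℕ) (hcard : Fintype.card V = n)
    (hT : T.IsTree) (k : ℕ) (hk1 : 1 ≤ k) (hkn : k ≤ n) :
    Sk T k ≤ (n : ℝ) - 2 + 2 * k - (2 * k - 2) / n := by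
  subst hcard
  obtain ⟨Z, hZ, htr, hx⟩ := exists_posSemidef_of_isTree hT
  have hn : (1 : ℝ) ≤ Fintype.card V := by exact_mod_cast hk1.trans hkn
  have hc : (0 : ℝ) ≤ 2 - 2 / Fintype.card V := by
    rw [sub_nonneg, div_le_iff₀ (by linarith)]
    linarith
  calc Sk T k ≤ (2 - 2 / Fintype.card V) * k + Z.trace := Sk_le_of_posSemidef T hZ hc hx k
    _ ≤ (2 - 2 / Fintype.card V) * k + (Fintype.card V - 2 + 2 / Fintype.card V) := by gcongr
    _ = (Fintype.card V : ℝ) - 2 + 2 * k - (2 * k - 2) / Fintype.card V := by ring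

end LapPaper
end
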